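/- arXiv:2408.09233 — 5 statements merged into one kernel-verified Lean document; each statement's English description precedes it below -/
import Mathlib

section
/- Let n ≥ 0. For all y, z ∈ ℝ^{n+1} with ‖y‖ = ‖z‖ = 1 and z ≠ −y, one has z − y ≠ −2y and σ(y, z−y) = z, where σ(y,v) := −y + (⟨2y, v+2y⟩/‖v+2y‖²)·(v+2y). In other words, with τ(y,z) := z − y, the pair (σ,τ) satisfies the section identity σ(y, τ(y,z)) = z for all (y,z) in N := {(y,z) ∈ 𝕊ⁿ × 𝕊ⁿ : z ≠ −y}. -/
open RealInnerProductSpace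

/-- The spray map `σ(y,v) = -y + (⟨2y, v+2y⟩/‖v+2y‖²)·(v+2y)` over the unit sphere. -/
noncomputable def sphereSpray {n : ℕ} (y v : EuclideanSpace ℝ (Fin (n + 1))) :
    EuclideanSpace ℝ (Fin (n + 1)) :=
  -y + (⟪(2 : ℝ) • y, v + (2 : ℝ) • y⟫ / ‖v + (2 : ℝ) • y‖ ^ 2) • (v + (2 : ℝ) • y)

/-- Section identity: for `y, z` on the unit sphere with `z ≠ -y`, setting `τ(y,z) := z - y`
one has `z - y ≠ -2y` and `σ(y, τ(y,z)) = z`. -/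
theorem sphereSpray_section (n : ℕ) (y z : EuclideanSpace ℝ (Fin (n + 1)))
    (hy : ‖y‖ = 1) (hz : ‖z‖ = 1) (hzy : z ≠ -y) :
    z - y ≠ -((2 : ℝ) • y) ∧ sphereSpray y (z - y) = z := by
  have hv : z - y + (2 : ℝ) • y = z + y := by module
  have hne : z + y ≠ 0 := fun h => hzy (eq_neg_of_add_eq_zero_left h)
  refine ⟨fun h => hne ?_, ?_⟩
  · rw [← hv, h, neg_add_cancel]
  · have hnorm : ‖z + y‖ ^ 2 ≠ 0 := pow_ne_zero 2 (norm_ne_zero_iff.mpr hne)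
    have hinner : ⟪(2 : ℝ) • y, z + y⟫ = ‖z + y‖ ^ 2 := by
      rw [norm_add_sq_real, real_inner_smul_left, inner_add_right,
        real_inner_self_eq_norm_sq, real_inner_comm, hy, hz]
      ring
    rw [sphereSpray, hv, hinner, div_self hnorm, one_smul]
    abel
end

section
/- Let n ≥ 0 and let y ∈ ℝ^{n+1} with ‖y‖ = 1. The map v ↦ σ(y,v) := −y + (⟨2y, v+2y⟩/‖v+2y‖²)·(v+2y), which is defined on the open set {v : v ≠ −2y} containing 0, is Fréchet differentiable at v = 0 and its derivative there is the linear map h ↦ h − ⟨y,h⟩·y, i.e. the orthogonal projection of ℝ^{n+1} onto the hyperplane y^⊥ = {h : ⟨y,h⟩ = 0}. In particular the range of this derivative is the tangent space to the unit sphere at y, so v ↦ σ(y,v) is a submersion onto the sphere at v = 0. -/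
open RealInnerProductSpace

/-- For `y` on the unit sphere, the map `v ↦ σ(y,v)` is Fréchet differentiable at `0`, with
derivative the orthogonal projection `h ↦ h - ⟨y,h⟩·y` onto the hyperplane `y^⊥`; in
particular the range of the derivative is the tangent space `{h : ⟨y,h⟩ = 0}` to the sphere
at `y`, so `v ↦ σ(y,v)` is a submersion at `0`. -/
theorem sphereSpray_hasFDerivAt_zero (n : ℕ) (y : EuclideanSpace ℝ (Fin (n + 1)))
    (hy : ‖y‖ = 1) :
    ∃ D : EuclideanSpace ℝ (Fin (n + 1)) →L[ℝ] EuclideanSpace ℝ (Fin (n + 1)),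
      (∀ h, D h = h - ⟪y, h⟫ • y) ∧
      HasFDerivAt (fun v => sphereSpray y v) D 0 ∧
      Set.range D = {h | ⟪y, h⟫ = 0} := by
  have hz : ‖(0 : EuclideanSpace ℝ (Fin (n + 1))) + (2 : ℝ) • y‖ ^ 2 = 4 := by
    rw [zero_add, norm_smul, hy]; norm_num
  have hw : HasFDerivAt (fun v : EuclideanSpace ℝ (Fin (n + 1)) => v + (2 : ℝ) • y)
      (ContinuousLinearMap.id ℝ _) 0 := (hasFDerivAt_id _).add_const _
  have hg := (hasFDerivAt_const ((2 : ℝ) • y) (0 : EuclideanSpace ℝ (Fin (n + 1)))).inner ℝ hw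
  have hN := (hasDerivAt_inv (by rw [hz]; norm_num)).comp_hasFDerivAt
    (0 : EuclideanSpace ℝ (Fin (n + 1))) hw.norm_sq
  have hσ := ((hg.mul hN).smul hw).const_add (-y)
  refine ⟨ContinuousLinearMap.id ℝ _ - (innerSL ℝ y).smulRight y, fun h => by simp, ?_, ?_⟩
  · refine hσ.congr_fderiv ?_
    ext1 h
    simp [hy, inner_smul_left, inner_smul_right, norm_smul, smul_smul]
    module
  · ext h
    constructor
    · rintro ⟨k, rfl⟩
      simp [inner_sub_right, inner_smul_right, hy]
    · intro hh
      exact ⟨h, by simp [show ⟪y, h⟫ = (0 : ℝ) from hh]⟩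
end

section
/- Let C be a topological space, let E be a real normed vector space, let H : C → E and ψ : C → ℝ be continuous with ψ(x) ≥ 0 for all x ∈ C, and let M > 0 be a real number. Suppose that the set A := {x ∈ C : ‖H(x)‖ ≥ 2M} is compact and that ψ(x) > 0 for every x ∈ A. Then there exists a natural number N such that ‖H(x)‖ ≤ 2M·(1+ψ(x))^N for all x ∈ C; equivalently, the damped function x ↦ (1+ψ(x))^{-N}·H(x) has norm at most 2M everywhere on C, while it agrees with H at every point where ψ vanishes. -/
/-- Damping a continuous map by powers of `1 + ψ`: if `H : C → E` and `ψ : C → ℝ` are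
continuous, `ψ ≥ 0`, `M > 0`, the set `A = {x : ‖H x‖ ≥ 2M}` is compact and `ψ > 0` on `A`,
then for some natural number `N` one has `‖H x‖ ≤ 2M·(1+ψ x)^N` for all `x`; equivalently,
the damped map `x ↦ (1+ψ x)^{-N} • H x` has norm at most `2M` everywhere, while it agrees
with `H` wherever `ψ` vanishes. -/
theorem damping_bound {C : Type*} [TopologicalSpace C]
    {E : Type*} [NormedAddCommGroup E] [NormedSpace ℝ E]
    (H : C → E) (ψ : C → ℝ) (hH : Continuous H) (hψ : Continuous ψ)
    (hψ0 : ∀ x, 0 ≤ ψ x) (M : ℝ) (hM : 0 < M)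
    (hA : IsCompact {x : C | 2 * M ≤ ‖H x‖})
    (hApos : ∀ x ∈ {x : C | 2 * M ≤ ‖H x‖}, 0 < ψ x) :
    ∃ N : ℕ, ∀ x : C,
      ‖H x‖ ≤ 2 * M * (1 + ψ x) ^ N ∧
      ‖((1 + ψ x) ^ N)⁻¹ • H x‖ ≤ 2 * M ∧
      (ψ x = 0 → ((1 + ψ x) ^ N)⁻¹ • H x = H x) := by
  obtain ⟨δ, hδ, hδψ⟩ := hA.exists_forall_le' hψ.continuousOn hApos
  obtain ⟨K, hK⟩ := hA.exists_bound_of_continuousOn hH.continuousOn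
  obtain ⟨N, hN⟩ := pow_unbounded_of_one_lt (K / (2 * M)) (lt_add_of_pos_right 1 hδ)
  have hbound (x : C) : ‖H x‖ ≤ 2 * M * (1 + ψ x) ^ N := by
    by_cases hx : 2 * M ≤ ‖H x‖
    · calc ‖H x‖ ≤ K := hK x hx
        _ ≤ 2 * M * (1 + δ) ^ N := ((div_lt_iff₀' (by positivity)).1 hN).le
        _ ≤ 2 * M * (1 + ψ x) ^ N := by
          gcongr
          exact hδψ x hx
    · exact (not_le.1 hx).le.trans <| le_mul_of_one_le_right (by positivity) <|
        one_le_pow₀ (le_add_of_nonneg_right (hψ0 x))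
  refine ⟨N, fun x ↦ ⟨hbound x, ?_, fun hx ↦ by simp [hx]⟩⟩
  have hpos : 0 < (1 + ψ x) ^ N := pow_pos (add_pos_of_pos_of_nonneg one_pos (hψ0 x)) N
  rw [norm_smul, norm_inv, Real.norm_of_nonneg hpos.le, inv_mul_le_iff₀' hpos]
  exact hbound x
end

section
/- The set S := {(x,y,z) ∈ ℝ³ : x² + y² = z·(z−1)·(z−2)} is nonempty and is not connected (not preconnected). Indeed S is the disjoint union of the two nonempty relatively closed subsets S ∩ {z ≤ 1} and S ∩ {z ≥ 2}, since z·(z−1)·(z−2) < 0 for 1 < z < 2. -/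
/-- The affine cubic surface `x² + y² = z(z-1)(z-2)` in `ℝ³` is nonempty and disconnected. -/
theorem cubic_surface_nonempty_not_preconnected :
    ({p : ℝ × ℝ × ℝ | p.1 ^ 2 + p.2.1 ^ 2 = p.2.2 * (p.2.2 - 1) * (p.2.2 - 2)}).Nonempty ∧
    ¬ IsPreconnected
      {p : ℝ × ℝ × ℝ | p.1 ^ 2 + p.2.1 ^ 2 = p.2.2 * (p.2.2 - 1) * (p.2.2 - 2)} := by
  refine ⟨⟨(0, 0, 0), by simp⟩, fun h => ?_⟩
  obtain ⟨p, hp, hz⟩ := h.intermediate_value (a := (0, 0, 0)) (b := (0, 0, 2))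
    (by simp) (by simp) (f := fun p : ℝ × ℝ × ℝ => p.2.2) (by fun_prop)
    (show (3 / 2 : ℝ) ∈ Set.Icc 0 2 by norm_num)
  simp only [Set.mem_ofPred_eq] at hp hz
  rw [hz] at hp
  linarith [sq_nonneg p.1, sq_nonneg p.2.1]
end

section
/- Let R be a commutative ring, n a natural number, and P, Q ∈ R[v₁,…,vₙ] multivariate polynomials such that the constant coefficient of P is zero. Set c := constant coefficient of Q. Then there exist polynomials A, B ∈ R[v₁,…,vₙ], both with zero constant coefficient, such that substituting c·vᵢ for vᵢ yields the identities P(c·v₁,…,c·vₙ) = c·A(v₁,…,vₙ) and Q(c·v₁,…,c·vₙ) = c·(1 + B(v₁,…,vₙ)) in R[v₁,…,vₙ]. Consequently, when R = ℝ, for every point v ∈ ℝⁿ one has P(c·v)·(1 + B(v)) = A(v)·Q(c·v), and Q(c·v) ≠ 0 implies 1 + B(v) ≠ 0, so the rational function v ↦ P(c·v)/Q(c·v) equals A(v)/(1+B(v)) wherever it is defined, with denominator not vanishing at v = 0. -/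
open MvPolynomial

/-- Scaling all variables of `p` by `c` gives the constant coefficient of `p` plus `c` times a
polynomial with zero constant coefficient. -/
theorem MvPolynomial.exists_bind₁_C_mul_X_eq {σ R : Type*} [CommSemiring R] (c : R)
    (p : MvPolynomial σ R) :
    ∃ A : MvPolynomial σ R, constantCoeff A = 0 ∧
      bind₁ (fun i => C c * X i) p = C (constantCoeff p) + C c * A := by
  induction p using MvPolynomial.induction_on with
  | C a => exact ⟨0, by simp, by simp⟩
  | add p q hp hq =>
    obtain ⟨A, hA, hpA⟩ := hp
    obtain ⟨B, hB, hqB⟩ := hq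
    refine ⟨A + B, by simp [hA, hB], ?_⟩
    rw [map_add, hpA, hqB, map_add, map_add]
    ring
  | mul_X p i hp =>
    obtain ⟨A, -, hpA⟩ := hp
    refine ⟨(C (constantCoeff p) + C c * A) * X i, by simp, ?_⟩
    rw [map_mul, hpA, bind₁_X_right, map_mul, constantCoeff_X, mul_zero, map_zero]
    ring

/-- Rescaling a rational function by the constant term of its denominator: if `P, Q` are
polynomials in `v₁,…,vₙ` over a commutative ring `R`, the constant coefficient of `P` is
zero, and `c` is the constant coefficient of `Q`, then there exist polynomials `A, B` with
zero constant coefficient such that `P(c·v) = c·A(v)` and `Q(c·v) = c·(1 + B(v))`.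
Consequently `P(c·v)·(1 + B(v)) = A(v)·Q(c·v)` at every point `v`, if `Q(c·v) ≠ 0` then
`1 + B(v) ≠ 0`, and the denominator `1 + B` takes the value `1` at `v = 0`. -/
theorem rescale_by_constant_denominator {R : Type*} [CommRing R] {n : ℕ}
    (P Q : MvPolynomial (Fin n) R) (hP : constantCoeff P = 0) :
    ∃ A B : MvPolynomial (Fin n) R,
      constantCoeff A = 0 ∧ constantCoeff B = 0 ∧
      bind₁ (fun i => C (constantCoeff Q) * X i) P = C (constantCoeff Q) * A ∧
      bind₁ (fun i => C (constantCoeff Q) * X i) Q = C (constantCoeff Q) * (1 + B) ∧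
      (∀ v : Fin n → R,
        eval v (bind₁ (fun i => C (constantCoeff Q) * X i) P) * (1 + eval v B) =
          eval v A * eval v (bind₁ (fun i => C (constantCoeff Q) * X i) Q)) ∧
      (∀ v : Fin n → R,
        eval v (bind₁ (fun i => C (constantCoeff Q) * X i) Q) ≠ 0 → 1 + eval v B ≠ 0) ∧
      1 + eval (0 : Fin n → R) B = 1 := by
  obtain ⟨A, hA, hPA⟩ := exists_bind₁_C_mul_X_eq (constantCoeff Q) P
  obtain ⟨B, hB, hQB⟩ := exists_bind₁_C_mul_X_eq (constantCoeff Q) Q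
  rw [hP, map_zero, zero_add] at hPA
  rw [← mul_one_add] at hQB
  refine ⟨A, B, hA, hB, hPA, hQB, fun v => ?_, fun v hv h => hv ?_, ?_⟩
  · simp only [hPA, hQB, map_mul, map_add, map_one, eval_C]
    ring
  · simp [hQB, h]
  · simp [eval_zero, hB]
end
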